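/- Let C be an open convex cone in a finite-dimensional real vector space V, fix β ≥ 1/2, and let A, B, C', D : C → (0,∞). Suppose that the functions (x,y) ↦ (A(x) + B(x)y)^{-β} and (x,y) ↦ (C'(x) + D(x)y)^{-β} are completely monotone on C × (0,∞). Then the function (x,y) ↦ (A(x)C'(x) + (A(x)D(x) + B(x)C'(x))y)^{-β} is completely monotone on C × (0,∞). -/

import Mathlib

/-- Complete monotonicity on an (open convex cone) subset `C` of a real normed space:
`f` is `C^∞` on `C` and `(−1)^k D_{u_1}···D_{u_k} f(x) ≥ 0` for all `k ≥ 0`, all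
directions `u_1, …, u_k ∈ C` and all `x ∈ C`. -/
def CompletelyMonotoneOn {E : Type*} [NormedAddCommGroup E] [NormedSpace ℝ E]
    (f : E → ℝ) (C : Set E) : Prop :=
  ContDiffOn ℝ (⊤ : ℕ∞) f C ∧
    ∀ (k : ℕ) (u : Fin k → E), (∀ i, u i ∈ C) → ∀ x ∈ C,
      0 ≤ (-1 : ℝ) ^ k * iteratedFDerivWithin ℝ k f C x u

open Filter Topology MeasureTheory

section AlternatingDifferences

variable {E F : Type*} [AddCommGroup E] [AddCommGroup F]

/-- The alternating finite difference with steps `l`: the composition of the operators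
`f ↦ (x ↦ f x - f (x + u))` for `u ∈ l`. -/
def altDiff : List E → (E → ℝ) → E → ℝ
  | [], f => f
  | u :: l, f => altDiff l (fun x => f x - f (x + u))

/-- All alternating finite differences of `f` with steps in `S` are nonnegative on `C`. -/
def AltNonneg (S C : Set E) (f : E → ℝ) : Prop :=
  ∀ l : List E, (∀ u ∈ l, u ∈ S) → ∀ x ∈ C, 0 ≤ altDiff l f x

lemma altDiff_comp {φ : E → F} {ψ : E → F} (h : ∀ x u, φ (x + u) = φ x + ψ u) (l : List E)
    (f : F → ℝ) (x : E) : altDiff l (fun x => f (φ x)) x = altDiff (l.map ψ) f (φ x) := by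
  induction l generalizing f with
  | nil => rfl
  | cons u l ih =>
    simp only [altDiff, List.map_cons]
    rw [← ih]
    simp only [h]

lemma altDiff_add (l : List E) (f g : E → ℝ) (x : E) :
    altDiff l (fun x => f x + g x) x = altDiff l f x + altDiff l g x := by
  induction l generalizing f g with
  | nil => rfl
  | cons u l ih =>
    simp only [altDiff]
    rw [← ih]
    congr 1
    ext y
    ring

lemma altDiff_const_mul (l : List E) (c : ℝ) (f : E → ℝ) (x : E) :
    altDiff l (fun x => c * f x) x = c * altDiff l f x := by
  induction l generalizing f with
  | nil => rfl
  | cons u l ih =>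
    simp only [altDiff]
    rw [← ih]
    congr 1
    ext y
    ring

lemma tendsto_altDiff {S C : Set E} (hC : ∀ x ∈ C, ∀ u ∈ S, x + u ∈ C) {ι : Type*} {p : Filter ι}
    {G : ι → E → ℝ} {f : E → ℝ} (h : ∀ x ∈ C, Tendsto (fun i => G i x) p (𝓝 (f x)))
    (l : List E) (hl : ∀ u ∈ l, u ∈ S) {x : E} (hx : x ∈ C) :
    Tendsto (fun i => altDiff l (G i) x) p (𝓝 (altDiff l f x)) := by
  induction l generalizing G f with
  | nil => exact h x hx
  | cons u l ih =>
    simp only [altDiff]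
    refine ih (fun y hy => ?_) (fun v hv => hl v (List.mem_cons_of_mem _ hv))
    exact (h y hy).sub (h _ (hC y hy u (hl u List.mem_cons_self)))

lemma integral_altDiff {S C : Set E} (hC : ∀ x ∈ C, ∀ u ∈ S, x + u ∈ C) {T : Type*}
    [MeasurableSpace T] {μ : Measure T} {G : T → E → ℝ}
    (h : ∀ x ∈ C, Integrable (fun t => G t x) μ)
    (l : List E) (hl : ∀ u ∈ l, u ∈ S) {x : E} (hx : x ∈ C) :
    ∀ f : E → ℝ, (∀ x ∈ C, f x = ∫ t, G t x ∂μ) →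
      altDiff l f x = ∫ t, altDiff l (G t) x ∂μ := by
  induction l generalizing G with
  | nil => exact fun f hf => hf x hx
  | cons u l ih =>
    intro f hf
    have hu := hl u List.mem_cons_self
    simp only [altDiff]
    refine ih (G := fun t z => G t z - G t (z + u))
      (fun y hy => (h y hy).sub (h _ (hC y hy u hu)))
      (fun v hv => hl v (List.mem_cons_of_mem _ hv)) _ (fun y hy => ?_)
    rw [integral_sub (h y hy) (h _ (hC y hy u hu)), hf y hy, hf _ (hC y hy u hu)]

namespace AltNonneg

variable {S C : Set E} {f g : E → ℝ}

lemma nonneg (hf : AltNonneg S C f) {x : E} (hx : x ∈ C) : 0 ≤ f x :=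
  hf [] (by simp) x hx

lemma mono {S' C' : Set E} (hf : AltNonneg S C f) (hS : S' ⊆ S) (hC : C' ⊆ C) :
    AltNonneg S' C' f :=
  fun l hl x hx => hf l (fun u hu => hS (hl u hu)) x (hC hx)

lemma sub_shift (hf : AltNonneg S C f) {u : E} (hu : u ∈ S) :
    AltNonneg S C (fun x => f x - f (x + u)) :=
  fun l hl x hx => hf (u :: l) (by simpa [hu] using hl) x hx

lemma comp {S' C' : Set F} {f : F → ℝ} (hf : AltNonneg S' C' f) {φ ψ : E → F}
    (h : ∀ x u, φ (x + u) = φ x + ψ u) (hφ : ∀ x ∈ C, φ x ∈ C') (hψ : ∀ u ∈ S, ψ u ∈ S') :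
    AltNonneg S C (fun x => f (φ x)) := by
  intro l hl x hx
  rw [altDiff_comp h]
  refine hf _ (fun u hu => ?_) _ (hφ x hx)
  obtain ⟨v, hv, rfl⟩ := List.mem_map.1 hu
  exact hψ v (hl v hv)

lemma shift (hf : AltNonneg S C f) (hC : ∀ x ∈ C, ∀ u ∈ S, x + u ∈ C) {u : E} (hu : u ∈ S) :
    AltNonneg S C (fun x => f (x + u)) :=
  hf.comp (ψ := id) (fun x v => by simp only [id]; abel) (fun x hx => hC x hx u hu) (fun _ h => h)

lemma const_mul (hf : AltNonneg S C f) {c : ℝ} (hc : 0 ≤ c) :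
    AltNonneg S C (fun x => c * f x) := by
  intro l hl x hx
  rw [altDiff_const_mul]
  exact mul_nonneg hc (hf l hl x hx)

lemma mul (hf : AltNonneg S C f) (hg : AltNonneg S C g) (hC : ∀ x ∈ C, ∀ u ∈ S, x + u ∈ C) :
    AltNonneg S C (fun x => f x * g x) := by
  intro l hl x hx
  induction l generalizing f g with
  | nil => exact mul_nonneg (hf.nonneg hx) (hg.nonneg hx)
  | cons u l ih =>
    have hu := hl u List.mem_cons_self
    have hl' : ∀ v ∈ l, v ∈ S := fun v hv => hl v (List.mem_cons_of_mem _ hv)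
    have : (fun x => f x * g x - f (x + u) * g (x + u)) =
        fun x => (f x - f (x + u)) * g x + f (x + u) * (g x - g (x + u)) := by
      ext y
      ring
    simp only [altDiff]
    rw [this, altDiff_add]
    exact add_nonneg (ih (hf.sub_shift hu) hg hl') (ih (hf.shift hC hu) (hg.sub_shift hu) hl')

lemma of_tendsto (hC : ∀ x ∈ C, ∀ u ∈ S, x + u ∈ C) {ι : Type*} {p : Filter ι} [p.NeBot]
    {G : ι → E → ℝ} (hG : ∀ᶠ i in p, AltNonneg S C (G i))
    (h : ∀ x ∈ C, Tendsto (fun i => G i x) p (𝓝 (f x))) : AltNonneg S C f :=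
  fun l hl _ hx => ge_of_tendsto (tendsto_altDiff hC h l hl hx)
    (hG.mono fun _ hi => hi l hl _ hx)

lemma congr (hC : ∀ x ∈ C, ∀ u ∈ S, x + u ∈ C) (hf : AltNonneg S C f)
    (h : ∀ x ∈ C, f x = g x) : AltNonneg S C g :=
  of_tendsto (p := (atTop : Filter ℕ)) (G := fun _ => f) hC (.of_forall fun _ => hf)
    fun x hx => by simp [h x hx]

lemma of_integral (hC : ∀ x ∈ C, ∀ u ∈ S, x + u ∈ C) {T : Type*}
    [MeasurableSpace T] {μ : Measure T} {G : T → E → ℝ} (hG : ∀ᵐ t ∂μ, AltNonneg S C (G t))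
    (h : ∀ x ∈ C, Integrable (fun t => G t x) μ) (hf : ∀ x ∈ C, f x = ∫ t, G t x ∂μ) :
    AltNonneg S C f := by
  intro l hl x hx
  rw [integral_altDiff hC h l hl hx f hf]
  exact integral_nonneg_of_ae (hG.mono fun t ht => ht l hl x hx)

lemma of_subset_closure [TopologicalSpace E] [ContinuousAdd E] {S' : Set E}
    (hC : ∀ x ∈ C, ∀ u ∈ S, x + u ∈ C) (hC' : ∀ x ∈ C, ∀ u ∈ S', x + u ∈ C)
    (hS' : S' ⊆ closure S) (hCo : IsOpen C) (hc : ContinuousOn f C)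
    (hf : AltNonneg S C f) : AltNonneg S' C f := by
  intro l hl x hx
  induction l generalizing f with
  | nil => exact hf.nonneg hx
  | cons u l ih =>
    have hu := hl u List.mem_cons_self
    have hsh : ∀ y ∈ C, Tendsto (fun v => f y - f (y + v)) (𝓝[S] u) (𝓝 (f y - f (y + u))) := by
      intro y hy
      refine tendsto_const_nhds.sub (Tendsto.mono_left ?_ nhdsWithin_le_nhds)
      have h1 : ContinuousAt f (y + u) := hc.continuousAt (hCo.mem_nhds (hC' y hy u hu))
      exact h1.tendsto.comp (Continuous.tendsto (by fun_prop) u)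
    have : (𝓝[S] u).NeBot := mem_closure_iff_nhdsWithin_neBot.1 (hS' hu)
    refine ih ?_ ?_ (fun v hv => hl v (List.mem_cons_of_mem _ hv))
    · refine hc.sub (hc.comp (by fun_prop) fun y hy => hC' y hy u hu)
    · exact of_tendsto hC (eventually_mem_nhdsWithin.mono fun v hv => hf.sub_shift hv) hsh

end AltNonneg

end AlternatingDifferences

section SmoothFunctions

variable {E : Type*} [NormedAddCommGroup E] [NormedSpace ℝ E] {C : Set E} {f : E → ℝ}

lemma iteratedFDerivWithin_succ_apply_last (ho : IsOpen C) (hf : ContDiffOn ℝ (⊤ : ℕ∞) f C)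
    {k : ℕ} {x : E} (hx : x ∈ C) (u : Fin (k + 1) → E) :
    iteratedFDerivWithin ℝ (k + 1) f C x u =
      iteratedFDerivWithin ℝ k (fun y => fderivWithin ℝ f C y (u (Fin.last k))) C x
        (Fin.init u) := by
  rw [iteratedFDerivWithin_succ_apply_right ho.uniqueDiffOn hx]
  have h : ContDiffOn ℝ k (fderivWithin ℝ f C) C :=
    hf.fderivWithin ho.uniqueDiffOn (by exact_mod_cast le_top)
  exact (iteratedFDerivWithin_clm_apply_const_apply ho.uniqueDiffOn h le_rfl hx).symm

lemma tendsto_sub_shift_div (ho : IsOpen C) (hf : ContDiffOn ℝ (⊤ : ℕ∞) f C) {x : E} (hx : x ∈ C)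
    (u : E) : Tendsto (fun t : ℝ => t⁻¹ * (f x - f (x + t • u))) (𝓝[>] 0)
      (𝓝 (-(fderivWithin ℝ f C x u))) := by
  have h1 : HasFDerivAt f (fderivWithin ℝ f C x) x :=
    ((hf.differentiableOn (by simp)) x hx).hasFDerivWithinAt.hasFDerivAt (ho.mem_nhds hx)
  have h2 := (h1.hasLineDerivAt u).tendsto_slope_zero_right.neg
  refine h2.congr fun t => ?_
  simp only [smul_eq_mul]
  ring

lemma AltNonneg.completelyMonotoneOn (ho : IsOpen C) (hadd : ∀ x ∈ C, ∀ u ∈ C, x + u ∈ C)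
    (hcone : ∀ x ∈ C, ∀ t : ℝ, 0 < t → t • x ∈ C) (hsm : ContDiffOn ℝ (⊤ : ℕ∞) f C)
    (hf : AltNonneg C C f) : CompletelyMonotoneOn f C := by
  refine ⟨hsm, fun k => ?_⟩
  induction k generalizing f with
  | zero =>
    intro u _ x hx
    simpa using hf.nonneg hx
  | succ k ih =>
    intro u hu x hx
    have hs : ContDiffOn ℝ (⊤ : ℕ∞) (fun y => fderivWithin ℝ f C y (u (Fin.last k))) C :=
      (hsm.fderivWithin ho.uniqueDiffOn (by exact_mod_cast le_top)).clm_apply contDiffOn_const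
    have hn : AltNonneg C C (fun y => -(fderivWithin ℝ f C y (u (Fin.last k)))) := by
      refine AltNonneg.of_tendsto hadd ?_
        fun y hy => tendsto_sub_shift_div ho hsm hy (u (Fin.last k))
      filter_upwards [self_mem_nhdsWithin] with t ht
      exact (hf.sub_shift (hcone _ (hu _) t ht)).const_mul (inv_nonneg.2 (le_of_lt ht))
    have := ih hs.neg hn (Fin.init u) (fun i => hu _) x hx
    rw [iteratedFDerivWithin_succ_apply_last ho hsm hx]
    have e := iteratedFDerivWithin_neg_apply (𝕜 := ℝ) (i := k)
      (f := fun y => fderivWithin ℝ f C y (u (Fin.last k))) ho.uniqueDiffOn hx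
    have e' : (fun y => -(fderivWithin ℝ f C y (u (Fin.last k)))) =
      -fun y => fderivWithin ℝ f C y (u (Fin.last k)) := rfl
    rw [e', e, neg_apply] at this
    rw [pow_succ]
    linarith

lemma CompletelyMonotoneOn.sub_shift (ho : IsOpen C) (hadd : ∀ x ∈ C, ∀ u ∈ C, x + u ∈ C)
    (hcone : ∀ x ∈ C, ∀ t : ℝ, 0 < t → t • x ∈ C) (hf : CompletelyMonotoneOn f C)
    {w : E} (hw : w ∈ C) : CompletelyMonotoneOn (fun x => f x - f (x + w)) C := by
  obtain ⟨hsm, hf⟩ := hf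
  have hsh : ContDiffOn ℝ (⊤ : ℕ∞) (fun x => f (x + w)) C :=
    hsm.comp (by fun_prop) fun x hx => hadd x hx w hw
  refine ⟨hsm.sub hsh, fun k u hu x hx => ?_⟩
  have hkk : ((k : ℕ) : WithTop ℕ∞) ≤ ((⊤ : ℕ∞) : WithTop ℕ∞) := by exact_mod_cast le_top
  have e := iteratedFDerivWithin_sub_apply (i := k) ((hsm x hx).of_le hkk) ((hsh x hx).of_le hkk)
    ho.uniqueDiffOn hx
  have e2 : iteratedFDerivWithin ℝ k (fun x => f (x + w)) C x =
      iteratedFDerivWithin ℝ k f C (x + w) := by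
    rw [iteratedFDerivWithin_of_isOpen k ho hx, iteratedFDerivWithin_of_isOpen k ho (hadd x hx w hw),
      iteratedFDeriv_comp_add_right]
  have e' : (fun x => f x - f (x + w)) = f - fun x => f (x + w) := rfl
  rw [e', e, e2, sub_apply, mul_sub, sub_nonneg]
  have hmem : ∀ s : ℝ, 0 ≤ s → x + s • w ∈ C := by
    intro s hs
    rcases hs.eq_or_lt with rfl | hs
    · simpa using hx
    · exact hadd x hx _ (hcone w hw s hs)
  have hd : ∀ s : ℝ, 0 ≤ s → HasDerivAt
      (fun s : ℝ => (-1 : ℝ) ^ k * iteratedFDerivWithin ℝ k f C (x + s • w) u)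
      ((-1 : ℝ) ^ k * iteratedFDerivWithin ℝ (k + 1) f C (x + s • w) (Fin.cons w u)) s := by
    intro s hs
    have h1 : HasFDerivAt (iteratedFDerivWithin ℝ k f C)
        (fderivWithin ℝ (iteratedFDerivWithin ℝ k f C) C (x + s • w)) (x + s • w) :=
      ((hsm.differentiableOn_iteratedFDerivWithin (by exact_mod_cast ENat.natCast_lt_top k)
        ho.uniqueDiffOn) _ (hmem s hs)).hasFDerivWithinAt.hasFDerivAt (ho.mem_nhds (hmem s hs))
    have h2 : HasDerivAt (fun s : ℝ => x + s • w) w s := by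
      simpa using ((hasDerivAt_id s).smul_const w).const_add x
    have h3 := h1.comp_hasDerivAt s h2
    have h4 := ((ContinuousMultilinearMap.apply ℝ (fun _ : Fin k => E) ℝ u).hasFDerivAt
      (x := iteratedFDerivWithin ℝ k f C (x + s • w))).comp_hasDerivAt s h3
    rw [iteratedFDerivWithin_succ_apply_left]
    exact h4.const_mul _
  have hanti : AntitoneOn
      (fun s : ℝ => (-1 : ℝ) ^ k * iteratedFDerivWithin ℝ k f C (x + s • w) u) (Set.Ici 0) := by
    refine antitoneOn_of_deriv_nonpos (convex_Ici 0)
      (fun s hs => (hd s hs).continuousAt.continuousWithinAt)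
      (fun s hs => (hd s (interior_subset hs)).differentiableAt.differentiableWithinAt)
      (fun s hs => ?_)
    rw [(hd s (interior_subset hs)).deriv]
    have := hf (k + 1) (Fin.cons w u) (fun i => by refine Fin.cases ?_ ?_ i <;> simp [hw, hu])
      (x + s • w) (hmem s (interior_subset hs))
    rw [pow_succ] at this
    linarith
  simpa using hanti (Set.mem_Ici.2 le_rfl) (Set.mem_Ici.2 zero_le_one) zero_le_one

lemma CompletelyMonotoneOn.altNonneg (ho : IsOpen C) (hadd : ∀ x ∈ C, ∀ u ∈ C, x + u ∈ C)
    (hcone : ∀ x ∈ C, ∀ t : ℝ, 0 < t → t • x ∈ C) (hf : CompletelyMonotoneOn f C) :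
    AltNonneg C C f := by
  intro l hl x hx
  induction l generalizing f with
  | nil => simpa [altDiff] using hf.2 0 Fin.elim0 (fun i => i.elim0) x hx
  | cons u l ih =>
    exact ih (hf.sub_shift ho hadd hcone (hl u List.mem_cons_self))
      (fun v hv => hl v (List.mem_cons_of_mem _ hv))

end SmoothFunctions

section Mixtures

variable {E : Type*} [AddCommGroup E] {S C : Set E}

lemma AltNonneg.mul_rpow_neg (hC : ∀ x ∈ C, ∀ u ∈ S, x + u ∈ C) {f w : E → ℝ} {a : ℝ}
    (ha : 0 < a) (hw : ∀ x ∈ C, 0 < w x)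
    (h : ∀ s : ℝ, 0 < s → AltNonneg S C (fun x => f x * Real.exp (-(s * w x)))) :
    AltNonneg S C (fun x => f x * w x ^ (-a)) := by
  have hΓ := Real.Gamma_pos_of_pos ha
  have hI : ∀ x ∈ C, ∫ t in Set.Ioi (0 : ℝ), t ^ (a - 1) * Real.exp (-(w x * t)) =
      w x ^ (-a) * Real.Gamma a := by
    intro x hx
    rw [Real.integral_rpow_mul_exp_neg_mul_Ioi ha (hw x hx), one_div,
      Real.inv_rpow (hw x hx).le, Real.rpow_neg (hw x hx).le]
  have key : ∀ (t : ℝ) (x : E),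
      (Real.Gamma a)⁻¹ * t ^ (a - 1) * (f x * Real.exp (-(t * w x))) =
        ((Real.Gamma a)⁻¹ * f x) * (t ^ (a - 1) * Real.exp (-(w x * t))) := by
    intro t x
    rw [mul_comm t (w x)]
    ring
  refine AltNonneg.of_integral hC (μ := volume.restrict (Set.Ioi (0 : ℝ)))
    (G := fun t x => (Real.Gamma a)⁻¹ * t ^ (a - 1) * (f x * Real.exp (-(t * w x)))) ?_ ?_ ?_
  · filter_upwards [ae_restrict_mem measurableSet_Ioi] with t ht
    exact (h t ht).const_mul (mul_nonneg (inv_nonneg.2 hΓ.le) (Real.rpow_nonneg (le_of_lt ht) _))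
  · intro x hx
    simp only [key]
    refine Integrable.const_mul (Integrable.of_integral_ne_zero ?_) _
    rw [hI x hx]
    exact (mul_pos (Real.rpow_pos_of_pos (hw x hx) _) hΓ).ne'
  · intro x hx
    simp only [key]
    rw [integral_const_mul, hI x hx]
    field_simp

variable {P Q u v : E → ℝ}

lemma AltNonneg.gaussian_mixture (hC : ∀ x ∈ C, ∀ u ∈ S, x + u ∈ C)
    (hu : ∀ x ∈ C, 0 < u x) (hv : ∀ x ∈ C, 0 < v x)
    (hP : ∀ t : ℝ, 0 ≤ t → AltNonneg S C (fun x => P x * Real.exp (-(t * u x))))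
    (hQ : ∀ t : ℝ, 0 ≤ t → AltNonneg S C (fun x => Q x * Real.exp (-(t * v x))))
    (c : ℝ) {s : ℝ} (hs : 0 ≤ s) :
    AltNonneg S C (fun x => P x * Q x * (u x + v x) ^ (-(1 / 2) : ℝ) *
      Real.exp (-(c ^ 2 * (u x * v x / (u x + v x)))) * Real.exp (-(s * (u x + v x)))) := by
  have key : ∀ x ∈ C, ∀ a : ℝ,
      (√Real.pi)⁻¹ * ((P x * Real.exp (-((a ^ 2 + s) * u x))) *
        (Q x * Real.exp (-(((c - a) ^ 2 + s) * v x)))) =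
      ((√Real.pi)⁻¹ * (P x * Q x * Real.exp (-(c ^ 2 * (u x * v x / (u x + v x)))) *
        Real.exp (-(s * (u x + v x))))) *
        Real.exp (-(u x + v x) * (a - c * v x / (u x + v x)) ^ 2) := by
    intro x hx a
    have hw : u x + v x ≠ 0 := (add_pos (hu x hx) (hv x hx)).ne'
    have : Real.exp (-((a ^ 2 + s) * u x)) * Real.exp (-(((c - a) ^ 2 + s) * v x)) =
        Real.exp (-(c ^ 2 * (u x * v x / (u x + v x)))) * Real.exp (-(s * (u x + v x))) *
          Real.exp (-(u x + v x) * (a - c * v x / (u x + v x)) ^ 2) := by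
      rw [← Real.exp_add, ← Real.exp_add, ← Real.exp_add]
      congr 1
      field_simp
      ring
    linear_combination ((√Real.pi)⁻¹ * P x * Q x) * this
  refine AltNonneg.of_integral hC (μ := (volume : Measure ℝ))
    (G := fun a x => (√Real.pi)⁻¹ * ((P x * Real.exp (-((a ^ 2 + s) * u x))) *
        (Q x * Real.exp (-(((c - a) ^ 2 + s) * v x))))) ?_ ?_ ?_
  · refine .of_forall fun a => ?_
    exact ((hP _ (by positivity)).mul (hQ _ (by positivity)) hC).const_mul (by positivity)
  · intro x hx
    simp only [key x hx]
    exact ((integrable_exp_neg_mul_sq (add_pos (hu x hx) (hv x hx))).comp_sub_right _).const_mul _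
  · intro x hx
    have hw : 0 < u x + v x := add_pos (hu x hx) (hv x hx)
    simp only [key x hx]
    rw [integral_const_mul, integral_sub_right_eq_self
      (fun a : ℝ => Real.exp (-(u x + v x) * a ^ 2)), integral_gaussian,
      Real.sqrt_div Real.pi_pos.le, Real.rpow_neg hw.le, ← Real.sqrt_eq_rpow]
    have : √Real.pi ≠ 0 := (Real.sqrt_pos.2 Real.pi_pos).ne'
    field_simp

lemma AltNonneg.wishart_mixture (hC : ∀ x ∈ C, ∀ u ∈ S, x + u ∈ C)
    (hu : ∀ x ∈ C, 0 < u x) (hv : ∀ x ∈ C, 0 < v x)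
    (hP : ∀ t : ℝ, 0 ≤ t → AltNonneg S C (fun x => P x * Real.exp (-(t * u x))))
    (hQ : ∀ t : ℝ, 0 ≤ t → AltNonneg S C (fun x => Q x * Real.exp (-(t * v x))))
    {β : ℝ} (hβ : 1 / 2 ≤ β) {r : ℝ} (hr : 0 ≤ r) :
    AltNonneg S C (fun x => P x * Q x * (u x + v x) ^ (-β) *
      Real.exp (-(r * (u x * v x / (u x + v x))))) := by
  have hg := fun (s : ℝ) (hs : 0 ≤ s) =>
    AltNonneg.gaussian_mixture hC hu hv hP hQ (√r) (s := s) hs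
  simp only [Real.sq_sqrt hr] at hg
  rcases hβ.eq_or_lt with rfl | hβ
  · simpa using hg 0 le_rfl
  · refine (AltNonneg.mul_rpow_neg hC (sub_pos.2 hβ) (fun x hx => add_pos (hu x hx) (hv x hx))
      fun s hs => hg s hs.le).congr hC fun x hx => ?_
    have : (u x + v x) ^ (-β) = (u x + v x) ^ (-(1 / 2) : ℝ) * (u x + v x) ^ (-(β - 1 / 2)) := by
      rw [← Real.rpow_add (add_pos (hu x hx) (hv x hx))]
      congr 1
      ring
    rw [this]
    ring

lemma AltNonneg.series_mixture (hC : ∀ x ∈ C, ∀ u ∈ S, x + u ∈ C)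
    (hu : ∀ x ∈ C, 0 < u x) (hv : ∀ x ∈ C, 0 < v x)
    (hP : ∀ t : ℝ, 0 ≤ t → AltNonneg S C (fun x => P x * Real.exp (-(t * u x))))
    (hQ : ∀ t : ℝ, 0 ≤ t → AltNonneg S C (fun x => Q x * Real.exp (-(t * v x))))
    {β : ℝ} (hβ : 1 / 2 ≤ β) :
    AltNonneg (S ×ˢ Set.Ioi (0 : ℝ)) (C ×ˢ Set.Ioi (0 : ℝ)) (fun p : E × ℝ =>
      P p.1 * Q p.1 * (u p.1 * v p.1 + (u p.1 + v p.1) * p.2) ^ (-β)) := by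
  have hR : ∀ x ∈ Set.Ioi (0 : ℝ), ∀ u ∈ Set.Ioi (0 : ℝ), x + u ∈ Set.Ioi (0 : ℝ) :=
    fun x hx u hu => add_pos (Set.mem_Ioi.1 hx) (Set.mem_Ioi.1 hu)
  have hCR : ∀ x ∈ C ×ˢ Set.Ioi (0 : ℝ), ∀ u ∈ S ×ˢ Set.Ioi (0 : ℝ),
      x + u ∈ C ×ˢ Set.Ioi (0 : ℝ) :=
    fun x hx u hu => ⟨hC _ hx.1 _ hu.1, hR _ hx.2 _ hu.2⟩
  have hexp : ∀ r : ℝ, 0 ≤ r → AltNonneg (Set.Ioi (0 : ℝ)) (Set.Ioi (0 : ℝ))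
      (fun y => Real.exp (-(r * y))) := by
    intro r hr l hl x hx
    induction l generalizing x with
    | nil => exact (Real.exp_pos _).le
    | cons w l ih =>
      have : (fun y => Real.exp (-(r * y)) - Real.exp (-(r * (y + w)))) =
          fun y => (1 - Real.exp (-(r * w))) * Real.exp (-(r * y)) := by
        ext y
        rw [mul_add, neg_add, Real.exp_add]
        ring
      simp only [altDiff]
      rw [this, altDiff_const_mul]
      have hw : 0 < w := hl w List.mem_cons_self
      refine mul_nonneg (sub_nonneg.2 (Real.exp_le_one_iff.2 ?_))
        (ih (fun v hv => hl v (List.mem_cons_of_mem _ hv)) x hx)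
      have := mul_nonneg hr hw.le
      linarith
  have hβ0 : 0 < β := by linarith
  have hw : ∀ p ∈ C ×ˢ Set.Ioi (0 : ℝ), 0 < p.2 + u p.1 * v p.1 / (u p.1 + v p.1) := by
    intro p hp
    have h1 := hu _ hp.1
    have h2 := hv _ hp.1
    have h3 : 0 < p.2 := hp.2
    positivity
  have main := AltNonneg.mul_rpow_neg hCR (f := fun p : E × ℝ =>
    P p.1 * Q p.1 * (u p.1 + v p.1) ^ (-β)) hβ0 hw fun s hs => by
      have h1 := (AltNonneg.wishart_mixture hC hu hv hP hQ hβ hs.le).comp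
        (S := S ×ˢ Set.Ioi (0 : ℝ)) (C := C ×ˢ Set.Ioi (0 : ℝ))
        (φ := Prod.fst) (ψ := Prod.fst) (fun _ _ => rfl) (fun x hx => hx.1) (fun x hx => hx.1)
      have h2 := (hexp s hs.le).comp
        (S := S ×ˢ Set.Ioi (0 : ℝ)) (C := C ×ˢ Set.Ioi (0 : ℝ))
        (φ := Prod.snd) (ψ := Prod.snd) (fun _ _ => rfl) (fun x hx => hx.2) (fun x hx => hx.2)
      refine (h1.mul h2 hCR).congr hCR fun p _ => ?_
      rw [mul_add, neg_add, Real.exp_add]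
      ring
  refine main.congr hCR fun p hp => ?_
  have h1 : 0 < u p.1 + v p.1 := add_pos (hu _ hp.1) (hv _ hp.1)
  have : u p.1 * v p.1 + (u p.1 + v p.1) * p.2 =
      (u p.1 + v p.1) * (p.2 + u p.1 * v p.1 / (u p.1 + v p.1)) := by
    field_simp
    ring
  rw [this, Real.mul_rpow h1.le (hw p hp).le, mul_assoc]

end Mixtures

section InverseLaplace

variable {V : Type*} [NormedAddCommGroup V] [NormedSpace ℝ V] {K : Set V}

lemma tendsto_rpow_neg_exp {a b β t : ℝ} (ha : 0 < a) (hb : 0 < b) (ht : 0 < t) :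
    Tendsto (fun n : ℕ => (n / t : ℝ) ^ (β + n) * (b ^ n * (a + b * (n / t)) ^ (-β - n)))
      atTop (𝓝 (b ^ (-β) * Real.exp (-(t * (a / b))))) := by
  have h1 : Tendsto (fun n : ℕ => 1 + (t * (a / b)) / (n : ℝ)) atTop (𝓝 1) := by
    simpa using (tendsto_const_div_atTop_nhds_zero_nat (t * (a / b))).const_add 1
  have h2 := h1.rpow_const (p := -β) (Or.inl one_ne_zero)
  have h3 := (Real.tendsto_one_add_div_pow_exp (t * (a / b))).inv₀ (Real.exp_ne_zero _)
  have h4 := ((h2.mul h3).const_mul (b ^ (-β)))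
  rw [Real.one_rpow, one_mul, ← Real.exp_neg] at h4
  refine h4.congr' ?_
  filter_upwards [eventually_gt_atTop 0] with n hn
  have hn' : (0 : ℝ) < n := by exact_mod_cast hn
  have hy : 0 < (n : ℝ) / t := by positivity
  have hq : 0 < 1 + t * (a / b) / n := by positivity
  have e : a + b * (n / t) = b * (n / t) * (1 + t * (a / b) / n) := by
    field_simp
    ring
  have e2 : -β - (n : ℝ) = -(β + n) := by ring
  rw [e, Real.mul_rpow (by positivity) hq.le, Real.mul_rpow hb.le hy.le, e2, Real.rpow_neg hy.le,
    ← e2, Real.rpow_sub_natCast hb.ne', Real.rpow_sub_natCast hq.ne']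
  have : (n / t : ℝ) ^ (β + n) ≠ 0 := (Real.rpow_pos_of_pos hy _).ne'
  field_simp

lemma AltNonneg.rpow_neg_mul_exp (ho : IsOpen K) (hne : K.Nonempty)
    (hadd : ∀ x ∈ K, ∀ u ∈ K, x + u ∈ K)
    (hcone : ∀ x ∈ K, ∀ t : ℝ, 0 < t → t • x ∈ K) {β : ℝ} (hβ : 0 < β) {A B : V → ℝ}
    (hA : ∀ x ∈ K, 0 < A x) (hB : ∀ x ∈ K, 0 < B x)
    (hAc : ContinuousOn A K) (hBc : ContinuousOn B K)
    (h : AltNonneg (K ×ˢ Set.Ioi (0 : ℝ)) (K ×ˢ Set.Ioi (0 : ℝ))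
      (fun p : V × ℝ => (A p.1 + B p.1 * p.2) ^ (-β))) {t : ℝ} (ht : 0 ≤ t) :
    AltNonneg K K (fun x => B x ^ (-β) * Real.exp (-(t * (A x / B x)))) := by
  have hpos : ∀ p ∈ K ×ˢ Set.Ioi (0 : ℝ), 0 < A p.1 + B p.1 * p.2 := fun p hp =>
    add_pos (hA _ hp.1) (mul_pos (hB _ hp.1) hp.2)
  have hadd' : ∀ x ∈ K ×ˢ Set.Ioi (0 : ℝ), ∀ u ∈ K ×ˢ Set.Ioi (0 : ℝ),
      x + u ∈ K ×ˢ Set.Ioi (0 : ℝ) :=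
    fun x hx u hu => ⟨hadd _ hx.1 _ hu.1, add_pos (Set.mem_Ioi.1 hx.2) (Set.mem_Ioi.1 hu.2)⟩
  have hadd0 : ∀ x ∈ K ×ˢ Set.Ioi (0 : ℝ), ∀ u ∈ insert 0 K ×ˢ Set.Ici (0 : ℝ),
      x + u ∈ K ×ˢ Set.Ioi (0 : ℝ) := by
    rintro x hx u ⟨hu1, hu2⟩
    refine ⟨?_, add_pos_of_pos_of_nonneg (Set.mem_Ioi.1 hx.2) (Set.mem_Ici.1 hu2)⟩
    rcases hu1 with hu1 | hu1
    · simpa [hu1] using hx.1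
    · exact hadd _ hx.1 _ hu1
  have hcl : insert 0 K ×ˢ Set.Ici (0 : ℝ) ⊆ closure (K ×ˢ Set.Ioi (0 : ℝ)) := by
    rw [closure_prod_eq, closure_Ioi]
    refine Set.prod_mono (Set.insert_subset ?_ subset_closure) subset_rfl
    obtain ⟨x, hx⟩ := hne
    have : Tendsto (fun s : ℝ => s • x) (𝓝[>] 0) (𝓝 0) := by
      have : Continuous (fun s : ℝ => s • x) := by fun_prop
      simpa using (this.tendsto 0).mono_left nhdsWithin_le_nhds
    exact mem_closure_of_tendsto this
      (eventually_mem_nhdsWithin.mono fun s hs => hcone x hx s hs)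
  have hcont : ContinuousOn (fun p : V × ℝ => (A p.1 + B p.1 * p.2) ^ (-β))
      (K ×ˢ Set.Ioi (0 : ℝ)) := by
    have h1 : ContinuousOn (fun p : V × ℝ => A p.1) (K ×ˢ Set.Ioi (0 : ℝ)) :=
      hAc.comp continuousOn_fst fun p hp => hp.1
    have h2 : ContinuousOn (fun p : V × ℝ => B p.1) (K ×ˢ Set.Ioi (0 : ℝ)) :=
      hBc.comp continuousOn_fst fun p hp => hp.1
    exact (h1.add (h2.mul continuousOn_snd)).rpow_const fun p hp => Or.inl (hpos p hp).ne'
  have h0 := h.of_subset_closure hadd' hadd0 hcl (ho.prod isOpen_Ioi) hcont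
  have hn : ∀ n : ℕ, AltNonneg (insert 0 K ×ˢ Set.Ici (0 : ℝ)) (K ×ˢ Set.Ioi (0 : ℝ))
      (fun p : V × ℝ => B p.1 ^ n * (A p.1 + B p.1 * p.2) ^ (-β - n)) := by
    intro n
    induction n with
    | zero => simpa using h0
    | succ n ih =>
      have hβn : 0 < β + n := by positivity
      refine AltNonneg.of_tendsto hadd0 (p := 𝓝[>] (0 : ℝ)) (G := fun t p => (β + n)⁻¹ * (t⁻¹ *
        (B p.1 ^ n * (A p.1 + B p.1 * p.2) ^ (-β - n) - B (p + ((0 : V), t)).1 ^ n *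
          (A (p + ((0 : V), t)).1 + B (p + ((0 : V), t)).1 * (p + ((0 : V), t)).2) ^ (-β - n))))
        ?_ ?_
      · filter_upwards [self_mem_nhdsWithin] with t ht
        have ht' : (0 : ℝ) < t := ht
        exact ((ih.sub_shift (u := ((0 : V), t)) ⟨Set.mem_insert _ _, ht'.le⟩).const_mul
          (inv_nonneg.2 ht'.le)).const_mul (inv_nonneg.2 hβn.le)
      · intro p hp
        have hd : HasDerivAt (fun y : ℝ => A p.1 + B p.1 * y) (B p.1) p.2 := by
          simpa using ((hasDerivAt_id p.2).const_mul (B p.1)).const_add (A p.1)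
        have hd2 := ((hd.rpow_const (p := -β - n) (Or.inl (hpos p hp).ne')).const_mul
          (B p.1 ^ n)).tendsto_slope_zero_right.neg.const_mul (β + n)⁻¹
        have e : -β - ((n + 1 : ℕ) : ℝ) = -β - n - 1 := by
          push_cast
          ring
        have e2 : B p.1 ^ (n + 1) * (A p.1 + B p.1 * p.2) ^ (-β - ((n + 1 : ℕ) : ℝ)) =
            (β + n)⁻¹ * -(B p.1 ^ n * (B p.1 * (-β - n) *
              (A p.1 + B p.1 * p.2) ^ (-β - n - 1))) := by
          rw [e]
          field_simp
          ring
        rw [e2]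
        refine hd2.congr fun t => ?_
        simp only [smul_eq_mul, Prod.fst_add, Prod.snd_add, add_zero]
        ring
  have hslice : ∀ (n : ℕ) (y : ℝ), 0 < y →
      AltNonneg K K (fun x => B x ^ n * (A x + B x * y) ^ (-β - n)) := fun n y hy =>
    (hn n).comp (φ := fun x => (x, y)) (ψ := fun u => (u, 0)) (fun x u => by simp)
      (fun x hx => ⟨hx, hy⟩) (fun u hu => ⟨Set.mem_insert_of_mem _ hu, Set.mem_Ici.2 le_rfl⟩)
  have hexp : ∀ t : ℝ, 0 < t →
      AltNonneg K K (fun x => B x ^ (-β) * Real.exp (-(t * (A x / B x)))) := by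
    intro t ht
    refine AltNonneg.of_tendsto hadd (p := (atTop : Filter ℕ)) ?_
      fun x hx => tendsto_rpow_neg_exp (hA x hx) (hB x hx) ht
    filter_upwards [eventually_gt_atTop 0] with n hn
    have hn' : (0 : ℝ) < n := by exact_mod_cast hn
    exact (hslice n (n / t) (by positivity)).const_mul (by positivity)
  rcases ht.eq_or_lt with rfl | ht
  · refine AltNonneg.of_tendsto hadd (p := 𝓝[>] (0 : ℝ))
      (eventually_mem_nhdsWithin.mono hexp) fun x hx => ?_
    have : Continuous fun t : ℝ => B x ^ (-β) * Real.exp (-(t * (A x / B x))) := by fun_prop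
    exact (this.tendsto 0).mono_left nhdsWithin_le_nhds
  · exact hexp t ht

lemma contDiffOn_of_rpow_affine {n : WithTop ℕ∞} {β : ℝ} (hβ : β ≠ 0) {A B : V → ℝ}
    (hA : ∀ x ∈ K, 0 < A x) (hB : ∀ x ∈ K, 0 < B x)
    (h : ContDiffOn ℝ n (fun p : V × ℝ => (A p.1 + B p.1 * p.2) ^ (-β))
      (K ×ˢ Set.Ioi (0 : ℝ))) :
    ContDiffOn ℝ n A K ∧ ContDiffOn ℝ n B K := by
  have hs : ∀ y : ℝ, 0 < y → ContDiffOn ℝ n (fun x => A x + B x * y) K := by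
    intro y hy
    have hpos : ∀ x ∈ K, 0 < A x + B x * y := fun x hx =>
      add_pos (hA x hx) (mul_pos (hB x hx) hy)
    have h1 : ContDiffOn ℝ n (fun x => (A x + B x * y) ^ (-β)) K :=
      h.comp (f := fun x : V => (x, y)) (by fun_prop) fun x hx => ⟨hx, hy⟩
    refine (h1.rpow_const_of_ne (p := (-β)⁻¹)
      fun x hx => (Real.rpow_pos_of_pos (hpos x hx) _).ne').congr fun x hx => ?_
    exact (Real.rpow_rpow_inv (hpos x hx).le (neg_ne_zero.2 hβ)).symm
  have h1 := hs 1 one_pos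
  have h2 := hs 2 two_pos
  refine ⟨((contDiffOn_const (c := (2 : ℝ))).mul h1 |>.sub h2).congr fun x _ => ?_,
    (h2.sub h1).congr fun x _ => ?_⟩ <;> ring

end InverseLaplace

/-- analytic series connection.  Let `K` be an open convex cone in a
finite-dimensional real vector space `V`, `β ≥ 1/2`, and `A, B, C', D : K → (0,∞)`.  If
`(A+By)^{-β}` and `(C'+Dy)^{-β}` are completely monotone on `K × (0,∞)`, then so is
`(AC' + (AD+BC')y)^{-β}`. -/
theorem completely_monotone_series_connection
    {V : Type*} [NormedAddCommGroup V] [NormedSpace ℝ V] [FiniteDimensional ℝ V]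
    (K : Set V) (hne : K.Nonempty) (hopen : IsOpen K) (hconv : Convex ℝ K)
    (hcone : ∀ x ∈ K, ∀ t : ℝ, 0 < t → t • x ∈ K)
    (β : ℝ) (hβ : (1 : ℝ) / 2 ≤ β)
    (A B C' D : V → ℝ)
    (hA : ∀ x ∈ K, 0 < A x) (hB : ∀ x ∈ K, 0 < B x)
    (hC' : ∀ x ∈ K, 0 < C' x) (hD : ∀ x ∈ K, 0 < D x)
    (h1 : CompletelyMonotoneOn (fun p : V × ℝ => (A p.1 + B p.1 * p.2) ^ (-β))
            (K ×ˢ Set.Ioi (0 : ℝ)))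
    (h2 : CompletelyMonotoneOn (fun p : V × ℝ => (C' p.1 + D p.1 * p.2) ^ (-β))
            (K ×ˢ Set.Ioi (0 : ℝ))) :
    CompletelyMonotoneOn
      (fun p : V × ℝ =>
        (A p.1 * C' p.1 + (A p.1 * D p.1 + B p.1 * C' p.1) * p.2) ^ (-β))
      (K ×ˢ Set.Ioi (0 : ℝ)) := by
  have hβ0 : 0 < β := by linarith
  have hadd : ∀ x ∈ K, ∀ u ∈ K, x + u ∈ K := by
    intro x hx u hu
    have := hcone _ (hconv hx hu (a := 1 / 2) (b := 1 / 2) (by norm_num) (by norm_num)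
      (by norm_num)) 2 two_pos
    simpa [smul_smul] using this
  have hadd' : ∀ x ∈ K ×ˢ Set.Ioi (0 : ℝ), ∀ u ∈ K ×ˢ Set.Ioi (0 : ℝ),
      x + u ∈ K ×ˢ Set.Ioi (0 : ℝ) :=
    fun x hx u hu => ⟨hadd _ hx.1 _ hu.1, add_pos (Set.mem_Ioi.1 hx.2) (Set.mem_Ioi.1 hu.2)⟩
  have hcone' : ∀ x ∈ K ×ˢ Set.Ioi (0 : ℝ), ∀ t : ℝ, 0 < t → t • x ∈ K ×ˢ Set.Ioi (0 : ℝ) :=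
    fun x hx t ht => ⟨hcone _ hx.1 t ht, mul_pos ht (Set.mem_Ioi.1 hx.2)⟩
  have hopen' : IsOpen (K ×ˢ Set.Ioi (0 : ℝ)) := hopen.prod isOpen_Ioi
  obtain ⟨hAs, hBs⟩ := contDiffOn_of_rpow_affine hβ0.ne' hA hB h1.1
  obtain ⟨hCs, hDs⟩ := contDiffOn_of_rpow_affine hβ0.ne' hC' hD h2.1
  have hP := fun (t : ℝ) (ht : 0 ≤ t) =>
    AltNonneg.rpow_neg_mul_exp hopen hne hadd hcone hβ0 hA hB hAs.continuousOn hBs.continuousOn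
      (h1.altNonneg hopen' hadd' hcone') ht
  have hQ := fun (t : ℝ) (ht : 0 ≤ t) =>
    AltNonneg.rpow_neg_mul_exp hopen hne hadd hcone hβ0 hC' hD hCs.continuousOn hDs.continuousOn
      (h2.altNonneg hopen' hadd' hcone') ht
  have hmix := AltNonneg.series_mixture hadd (fun x hx => div_pos (hA x hx) (hB x hx))
    (fun x hx => div_pos (hC' x hx) (hD x hx)) hP hQ hβ
  refine AltNonneg.completelyMonotoneOn hopen' hadd' hcone' ?_
    (hmix.congr hadd' fun p hp => ?_)
  · have hfst : ∀ {f : V → ℝ}, ContDiffOn ℝ (⊤ : ℕ∞) f K →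
        ContDiffOn ℝ (⊤ : ℕ∞) (fun p : V × ℝ => f p.1) (K ×ˢ Set.Ioi (0 : ℝ)) :=
      fun hf => hf.comp contDiffOn_fst fun p hp => hp.1
    refine (((hfst hAs).mul (hfst hCs)).add ((((hfst hAs).mul (hfst hDs)).add
      ((hfst hBs).mul (hfst hCs))).mul contDiffOn_snd)).rpow_const_of_ne fun p hp => ?_
    have a := hA _ hp.1
    have b := hB _ hp.1
    have c := hC' _ hp.1
    have d := hD _ hp.1
    have y : 0 < p.2 := hp.2
    positivity
  · have a := hA _ hp.1
    have b := hB _ hp.1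
    have c := hC' _ hp.1
    have d := hD _ hp.1
    have y : 0 < p.2 := hp.2
    rw [← Real.mul_rpow b.le d.le, ← Real.mul_rpow (by positivity) (by positivity)]
    congr 1
    field_simp
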